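/- Pauli Twirl (equal-Pauli case): Let n : ℕ and let s : Fin n → Fin 4 be a Pauli label. Then for every matrix ρ : Matrix (Fin n → Fin 2) (Fin n → Fin 2) ℂ, the sum over all n-qubit Pauli labels q : Fin n → Fin 4 of (P_q * P_s * P_q) * ρ * (P_q * P_s * P_q) equals 4^n • (P_s * ρ * P_s). -/

import Mathlib

open Matrix

/-- Single-qubit Pauli matrices indexed by `Fin 4`: I, X, Y, Z. -/
def pauli : Fin 4 → Matrix (Fin 2) (Fin 2) ℂ
  | 0 => !![1, 0; 0, 1]
  | 1 => !![0, 1; 1, 0]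
  | 2 => !![0, -Complex.I; Complex.I, 0]
  | 3 => !![1, 0; 0, -1]

/-- The `n`-qubit Pauli tensor indexed by a label `s : Fin n → Fin 4`. -/
def pauliTensor {n : ℕ} (s : Fin n → Fin 4) :
    Matrix (Fin n → Fin 2) (Fin n → Fin 2) ℂ :=
  Matrix.of fun f g => ∏ k, pauli (s k) (f k) (g k)

/-- Conjugating a Pauli matrix by a Pauli matrix multiplies it by a sign. -/
lemma exists_pauli_conj_eq_smul (a b : Fin 4) :
    ∃ c : ℂ, c * c = 1 ∧ pauli a * pauli b * pauli a = c • pauli b := by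
  by_cases h : a = 0 ∨ b = 0 ∨ a = b
  · refine ⟨1, by norm_num, ?_⟩
    revert h
    fin_cases a <;> fin_cases b <;> simp [pauli]
  · refine ⟨-1, by norm_num, ?_⟩
    revert h
    fin_cases a <;> fin_cases b <;> simp [pauli]

/-- Matrices that are entrywise products over the qubits multiply qubit by qubit. -/
lemma of_prod_mul_of_prod {n : ℕ} (A B : Fin n → Matrix (Fin 2) (Fin 2) ℂ) :
    (Matrix.of fun f g : Fin n → Fin 2 => ∏ k, A k (f k) (g k)) *
        (Matrix.of fun f g => ∏ k, B k (f k) (g k)) =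
      Matrix.of fun f g => ∏ k, (A k * B k) (f k) (g k) := by
  ext f g
  simp only [Matrix.mul_apply, Matrix.of_apply, ← Finset.prod_mul_distrib]
  exact (Fintype.prod_sum fun k j => A k (f k) j * B k j (g k)).symm

/-- Conjugating a Pauli tensor by a Pauli tensor multiplies it by a sign. -/
lemma exists_pauliTensor_conj_eq_smul {n : ℕ} (q s : Fin n → Fin 4) :
    ∃ c : ℂ, c * c = 1 ∧
      pauliTensor q * pauliTensor s * pauliTensor q = c • pauliTensor s := by
  choose c hc h using fun k => exists_pauli_conj_eq_smul (q k) (s k)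
  refine ⟨∏ k, c k, by simp [← Finset.prod_mul_distrib, hc], ?_⟩
  simp only [pauliTensor, of_prod_mul_of_prod, h]
  ext f g
  simp [Finset.prod_mul_distrib]

/-- Pauli twirl, equal-Pauli case. -/
theorem pauli_twirl_eq (n : ℕ) (s : Fin n → Fin 4)
    (ρ : Matrix (Fin n → Fin 2) (Fin n → Fin 2) ℂ) :
    ∑ q : Fin n → Fin 4,
      (pauliTensor q * pauliTensor s * pauliTensor q) * ρ *
        (pauliTensor q * pauliTensor s * pauliTensor q) =
      (4 ^ n : ℂ) • (pauliTensor s * ρ * pauliTensor s) := by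
  have h (q : Fin n → Fin 4) :
      (pauliTensor q * pauliTensor s * pauliTensor q) * ρ *
        (pauliTensor q * pauliTensor s * pauliTensor q) =
      pauliTensor s * ρ * pauliTensor s := by
    obtain ⟨c, hc, h⟩ := exists_pauliTensor_conj_eq_smul q s
    simp [h, smul_smul, hc]
  simp only [h, Finset.sum_const, Finset.card_univ, Fintype.card_fun, Fintype.card_fin]
  rw [← Nat.cast_smul_eq_nsmul ℂ]
  push_cast
  rfl
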